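/- arXiv:math/0609325 — 8 statements merged into one kernel-verified Lean document; each statement's English description precedes it below -/
import Mathlib

section
/- For every real H > 0, the improper integral ∫₀^∞ 16(1+4H²) r (1+r²)² / ((r²−1)² + 4H²(r²+1)²)² dr converges, and its value multiplied by 2π equals 2π ( 1/H² + ((1+4H²)/(4H³)) ( π/2 − arctan((4H²−1)/(4H)) ) ). -/
open MeasureTheory Real Set

/-- The denominator of the conformal factor is positive. -/
lemma cmc_denom_pos {H : ℝ} (hH : 0 < H) (r : ℝ) :
    0 < (r ^ 2 - 1) ^ 2 + 4 * H ^ 2 * (r ^ 2 + 1) ^ 2 := by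
  positivity

/-- A primitive of the area density of the cmc sphere. -/
noncomputable def cmcAreaPrimitive (H r : ℝ) : ℝ :=
  (1 + 4 * H ^ 2) / (4 * H ^ 3) *
      arctan (((1 + 4 * H ^ 2) * r ^ 2 + (4 * H ^ 2 - 1)) / (4 * H)) -
    ((4 * H ^ 2 - 1) * r ^ 2 + (1 + 4 * H ^ 2)) /
      ((r ^ 2 - 1) ^ 2 + 4 * H ^ 2 * (r ^ 2 + 1) ^ 2) / H ^ 2

lemma hasDerivAt_cmcAreaPrimitive {H : ℝ} (hH : 0 < H) (r : ℝ) :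
    HasDerivAt (cmcAreaPrimitive H)
      (16 * (1 + 4 * H ^ 2) * r * (1 + r ^ 2) ^ 2 /
        ((r ^ 2 - 1) ^ 2 + 4 * H ^ 2 * (r ^ 2 + 1) ^ 2) ^ 2) r := by
  have hD := cmc_denom_pos hH r
  have ha : 0 < 1 + 4 * H ^ 2 := by positivity
  have hsq : HasDerivAt (fun x : ℝ => x ^ 2) (2 * r) r := by
    simpa using hasDerivAt_pow 2 r
  have harg := ((hsq.const_mul (1 + 4 * H ^ 2)).add_const (4 * H ^ 2 - 1)).div_const (4 * H)
  have hnum := (hsq.const_mul (4 * H ^ 2 - 1)).add_const (1 + 4 * H ^ 2)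
  have hden := ((hsq.sub_const 1).fun_pow 2).fun_add
    (((hsq.add_const 1).fun_pow 2).const_mul (4 * H ^ 2))
  have h := (harg.arctan.const_mul ((1 + 4 * H ^ 2) / (4 * H ^ 3))).fun_sub
    ((hnum.fun_div hden hD.ne').div_const (H ^ 2))
  have hkey : 1 + (((1 + 4 * H ^ 2) * r ^ 2 + (4 * H ^ 2 - 1)) / (4 * H)) ^ 2 =
      (1 + 4 * H ^ 2) * ((r ^ 2 - 1) ^ 2 + 4 * H ^ 2 * (r ^ 2 + 1) ^ 2) / (16 * H ^ 2) := by
    field_simp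
    ring
  refine h.congr_deriv ?_
  rw [hkey]
  have hD' := hD.ne'
  have ha' := ha.ne'
  field_simp
  ring

lemma tendsto_cmcAreaPrimitive_atTop {H : ℝ} (hH : 0 < H) :
    Filter.Tendsto (cmcAreaPrimitive H) Filter.atTop
      (nhds ((1 + 4 * H ^ 2) / (4 * H ^ 3) * (π / 2))) := by
  have ha : 0 < 1 + 4 * H ^ 2 := by positivity
  have hsq : Filter.Tendsto (fun r : ℝ => r ^ 2) Filter.atTop Filter.atTop :=
    Filter.tendsto_pow_atTop two_ne_zero
  have harctan : Filter.Tendsto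
      (fun r : ℝ => arctan (((1 + 4 * H ^ 2) * r ^ 2 + (4 * H ^ 2 - 1)) / (4 * H)))
      Filter.atTop (nhds (π / 2)) :=
    (tendsto_nhds_of_tendsto_nhdsWithin tendsto_arctan_atTop).comp
      ((Filter.tendsto_atTop_add_const_right _ _ (hsq.const_mul_atTop ha)).atTop_div_const
        (by positivity))
  have hrat : Filter.Tendsto
      (fun r : ℝ => ((4 * H ^ 2 - 1) * r ^ 2 + (1 + 4 * H ^ 2)) /
        ((r ^ 2 - 1) ^ 2 + 4 * H ^ 2 * (r ^ 2 + 1) ^ 2)) Filter.atTop (nhds 0) := by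
    refine squeeze_zero_norm
      (a := fun r : ℝ => (1 + 4 * H ^ 2) / (4 * H ^ 2) / (r ^ 2 + 1)) (fun r => ?_)
      ((Filter.tendsto_atTop_add_const_right _ _ hsq).const_div_atTop _)
    have hD := cmc_denom_pos hH r
    have hn : |(4 * H ^ 2 - 1) * r ^ 2 + (1 + 4 * H ^ 2)| ≤ (1 + 4 * H ^ 2) * (r ^ 2 + 1) := by
      have := mul_nonneg (sq_nonneg H) (sq_nonneg r)
      rw [abs_le]
      constructor <;> nlinarith [sq_nonneg r, sq_nonneg H]
    rw [norm_eq_abs, abs_div, abs_of_pos hD]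
    calc _ ≤ (1 + 4 * H ^ 2) * (r ^ 2 + 1) / (4 * H ^ 2 * (r ^ 2 + 1) ^ 2) :=
          div_le_div₀ (by positivity) hn (by positivity)
            (le_add_of_nonneg_left (sq_nonneg _))
      _ = _ := by field_simp
  have h :=
    (harctan.const_mul ((1 + 4 * H ^ 2) / (4 * H ^ 3))).sub (hrat.div_const (H ^ 2))
  rwa [zero_div, sub_zero] at h

lemma cmcAreaPrimitive_zero (H : ℝ) :
    cmcAreaPrimitive H 0 =
      (1 + 4 * H ^ 2) / (4 * H ^ 3) * arctan ((4 * H ^ 2 - 1) / (4 * H)) - 1 / H ^ 2 := by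
  have ha : 1 + 4 * H ^ 2 ≠ 0 := by positivity
  simp [cmcAreaPrimitive, div_self ha]

/-- The area integral of the cmc sphere `S_H` in the Heisenberg group:
the improper integral converges and `2π` times its value equals the explicit
formula for the area `A(H)`. -/
theorem area_of_cmc_sphere_in_Nil (H : ℝ) (hH : 0 < H) :
    IntegrableOn
      (fun r : ℝ =>
        16 * (1 + 4 * H ^ 2) * r * (1 + r ^ 2) ^ 2 /
          ((r ^ 2 - 1) ^ 2 + 4 * H ^ 2 * (r ^ 2 + 1) ^ 2) ^ 2)
      (Ioi (0 : ℝ)) ∧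
    2 * π * ∫ r in Ioi (0 : ℝ),
        16 * (1 + 4 * H ^ 2) * r * (1 + r ^ 2) ^ 2 /
          ((r ^ 2 - 1) ^ 2 + 4 * H ^ 2 * (r ^ 2 + 1) ^ 2) ^ 2
      = 2 * π * (1 / H ^ 2 +
          (1 + 4 * H ^ 2) / (4 * H ^ 3) *
            (π / 2 - arctan ((4 * H ^ 2 - 1) / (4 * H)))) := by
  have hderiv : ∀ r ∈ Ici (0 : ℝ), HasDerivAt (cmcAreaPrimitive H) _ r :=
    fun r _ => hasDerivAt_cmcAreaPrimitive hH r
  have hnonneg : ∀ r ∈ Ioi (0 : ℝ), 0 ≤ 16 * (1 + 4 * H ^ 2) * r * (1 + r ^ 2) ^ 2 /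
      ((r ^ 2 - 1) ^ 2 + 4 * H ^ 2 * (r ^ 2 + 1) ^ 2) ^ 2 := fun r hr => by
    have : 0 < r := hr
    positivity
  have hlim := tendsto_cmcAreaPrimitive_atTop hH
  refine ⟨integrableOn_Ioi_deriv_of_nonneg' hderiv hnonneg hlim, ?_⟩
  rw [integral_Ioi_of_hasDerivAt_of_nonneg' hderiv hnonneg hlim, cmcAreaPrimitive_zero]
  ring
end

section
/- For every real H > 0, the improper integral ∫₀^∞ 256 H (1+4H²) r³ (1+r²)² / ((r²−1)² + 4H²(r²+1)²)³ dr converges, and its value multiplied by π equals (π/(16H⁴)) ( 4H(4H²+3) − (4H²+1)(4H²−3) ( π/2 − arctan((4H²−1)/(4H)) ) ). -/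
open MeasureTheory Real Set

/-- The cotangent double-angle formula, for `arctan b⁻¹` with `b > 0`. -/
lemma two_mul_arctan_inv {b : ℝ} (hb : 0 < b) :
    2 * arctan b⁻¹ = π / 2 - arctan ((b ^ 2 - 1) / (2 * b)) := by
  have hpos : 0 < arctan b⁻¹ := by
    rw [← arctan_zero]
    exact arctan_strictMono (inv_pos.mpr hb)
  have htan : tan (π / 2 - 2 * arctan b⁻¹) = (b ^ 2 - 1) / (2 * b) := by
    rw [tan_pi_div_two_sub, tan_two_mul, tan_arctan, inv_div]
    field_simp
  have harctan := arctan_tan (x := π / 2 - 2 * arctan b⁻¹)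
    (by linarith [arctan_lt_pi_div_two b⁻¹]) (by linarith)
  rw [htan] at harctan
  linarith

/-- An antiderivative of `(1 - t ^ 2) / (t ^ 2 + b ^ 2) ^ 3`. -/
noncomputable def cmcPrimitive (b t : ℝ) : ℝ :=
  (1 + b ^ 2) / (4 * b ^ 2) * (t / (t ^ 2 + b ^ 2) ^ 2) +
    (3 - b ^ 2) / (8 * b ^ 4) * (t / (t ^ 2 + b ^ 2)) +
    (3 - b ^ 2) / (8 * b ^ 5) * arctan (t / b)

lemma hasDerivAt_cmcPrimitive {b : ℝ} (hb : b ≠ 0) (t : ℝ) :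
    HasDerivAt (cmcPrimitive b) ((1 - t ^ 2) / (t ^ 2 + b ^ 2) ^ 3) t := by
  have hden : t ^ 2 + b ^ 2 ≠ 0 := by positivity
  have hq : HasDerivAt (fun t : ℝ => t ^ 2 + b ^ 2) (2 * t) t := by
    simpa using (hasDerivAt_pow 2 t).add_const (b ^ 2)
  have h₁ := ((hasDerivAt_id' t).fun_div (hq.fun_pow 2) (pow_ne_zero 2 hden)).const_mul
    ((1 + b ^ 2) / (4 * b ^ 2))
  have h₂ := ((hasDerivAt_id' t).fun_div hq hden).const_mul ((3 - b ^ 2) / (8 * b ^ 4))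
  have h₃ := ((hasDerivAt_id' t).div_const b).arctan.const_mul ((3 - b ^ 2) / (8 * b ^ 5))
  refine ((h₁.fun_add h₂).fun_add h₃).congr_deriv ?_
  have harctan : 1 / (1 + (t / b) ^ 2) * (1 / b) = b / (t ^ 2 + b ^ 2) := by
    field_simp
    ring
  rw [harctan]
  field_simp
  ring

lemma cmcPrimitive_neg (b t : ℝ) : cmcPrimitive b (-t) = -cmcPrimitive b t := by
  simp only [cmcPrimitive, neg_sq, neg_div, arctan_neg]
  ring

lemma hasDerivAt_sq_sub_one_div_sq_add_one (r : ℝ) :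
    HasDerivAt (fun r : ℝ => (r ^ 2 - 1) / (r ^ 2 + 1)) (4 * r / (r ^ 2 + 1) ^ 2) r := by
  have hsq : HasDerivAt (fun r : ℝ => r ^ 2) (2 * r) r := by simpa using hasDerivAt_pow 2 r
  refine ((hsq.sub_const 1).fun_div (hsq.add_const 1) (by positivity)).congr_deriv ?_
  ring

lemma tendsto_sq_sub_one_div_sq_add_one :
    Filter.Tendsto (fun r : ℝ => (r ^ 2 - 1) / (r ^ 2 + 1)) Filter.atTop (nhds 1) := by
  have hinv : Filter.Tendsto (fun r : ℝ => (r ^ 2 + 1)⁻¹) Filter.atTop (nhds 0) :=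
    (Filter.tendsto_atTop_add_const_right _ 1
      (Filter.tendsto_pow_atTop two_ne_zero)).inv_tendsto_atTop
  have hlim := (hinv.const_mul 2).const_sub 1
  rw [mul_zero, sub_zero] at hlim
  refine hlim.congr fun r => ?_
  have hden : r ^ 2 + 1 ≠ 0 := by positivity
  field_simp
  ring

/-- The volume integral of the domain `D_H` bounded by the cmc sphere `S_H` in the
Heisenberg group: the improper integral converges and `π` times its value equals
the explicit formula for the volume `V(H)`. -/
theorem volume_of_cmc_sphere_in_Nil (H : ℝ) (hH : 0 < H) :
    IntegrableOn
      (fun r : ℝ =>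
        256 * H * (1 + 4 * H ^ 2) * r ^ 3 * (1 + r ^ 2) ^ 2 /
          ((r ^ 2 - 1) ^ 2 + 4 * H ^ 2 * (r ^ 2 + 1) ^ 2) ^ 3)
      (Ioi (0 : ℝ)) ∧
    π * ∫ r in Ioi (0 : ℝ),
        256 * H * (1 + 4 * H ^ 2) * r ^ 3 * (1 + r ^ 2) ^ 2 /
          ((r ^ 2 - 1) ^ 2 + 4 * H ^ 2 * (r ^ 2 + 1) ^ 2) ^ 3
      = π / (16 * H ^ 4) *
          (4 * H * (4 * H ^ 2 + 3) -
            (4 * H ^ 2 + 1) * (4 * H ^ 2 - 3) *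
              (π / 2 - arctan ((4 * H ^ 2 - 1) / (4 * H)))) := by
  have hb : 2 * H ≠ 0 := by positivity
  have hderiv (r : ℝ) : HasDerivAt
      (fun r : ℝ => 16 * H * (1 + 4 * H ^ 2) *
        cmcPrimitive (2 * H) ((r ^ 2 - 1) / (r ^ 2 + 1)))
      (256 * H * (1 + 4 * H ^ 2) * r ^ 3 * (1 + r ^ 2) ^ 2 /
        ((r ^ 2 - 1) ^ 2 + 4 * H ^ 2 * (r ^ 2 + 1) ^ 2) ^ 3) r := by
    refine (((hasDerivAt_cmcPrimitive hb _).comp r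
      (hasDerivAt_sq_sub_one_div_sq_add_one r)).const_mul _).congr_deriv ?_
    have hr : r ^ 2 + 1 ≠ 0 := by positivity
    have hD : (r ^ 2 - 1) ^ 2 + 4 * H ^ 2 * (r ^ 2 + 1) ^ 2 ≠ 0 := by positivity
    have hden : ((r ^ 2 - 1) / (r ^ 2 + 1)) ^ 2 + (2 * H) ^ 2 =
        ((r ^ 2 - 1) ^ 2 + 4 * H ^ 2 * (r ^ 2 + 1) ^ 2) / (r ^ 2 + 1) ^ 2 := by
      field_simp
      ring
    have hnum : 1 - ((r ^ 2 - 1) / (r ^ 2 + 1)) ^ 2 = 4 * r ^ 2 / (r ^ 2 + 1) ^ 2 := by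
      field_simp
      ring
    rw [hden, hnum]
    generalize (r ^ 2 - 1) ^ 2 + 4 * H ^ 2 * (r ^ 2 + 1) ^ 2 = D at hD ⊢
    field_simp
    ring
  have hnonneg : ∀ r ∈ Ioi (0 : ℝ), 0 ≤ 256 * H * (1 + 4 * H ^ 2) * r ^ 3 * (1 + r ^ 2) ^ 2 /
      ((r ^ 2 - 1) ^ 2 + 4 * H ^ 2 * (r ^ 2 + 1) ^ 2) ^ 3 := by
    intro r hr
    have hr₀ : 0 < r := hr
    positivity
  have hlim := ((hasDerivAt_cmcPrimitive hb 1).continuousAt.tendsto.comp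
    tendsto_sq_sub_one_div_sq_add_one).const_mul (16 * H * (1 + 4 * H ^ 2))
  refine ⟨integrableOn_Ioi_deriv_of_nonneg' (fun r _ => hderiv r) hnonneg hlim, ?_⟩
  rw [integral_Ioi_of_hasDerivAt_of_nonneg' (fun r _ => hderiv r) hnonneg hlim]
  have hzero : ((0 : ℝ) ^ 2 - 1) / (0 ^ 2 + 1) = -1 := by norm_num
  have harctan : π / 2 - arctan ((4 * H ^ 2 - 1) / (4 * H)) = 2 * arctan (2 * H)⁻¹ := by
    rw [two_mul_arctan_inv (by positivity)]
    ring_nf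
  rw [hzero, cmcPrimitive_neg, harctan, cmcPrimitive, one_div (2 * H)]
  have hden : 1 + 4 * H ^ 2 ≠ 0 := by positivity
  have hsq : (2 * H) ^ 2 = 4 * H ^ 2 := by ring
  rw [one_pow, hsq]
  generalize arctan (2 * H)⁻¹ = θ
  field_simp
  ring
end

section
/- For every real H > 0, the improper integral (π/2) ∫₀^∞ ( H² − (1/4) ((r²−1)/(r²+1))² ) · ( 16(1+4H²)(1+r²)² / ((r²−1)² + 4H²(r²+1)²)² ) · r dr converges and equals π. -/
open MeasureTheory Real Set

theorem cmcSphere_denom_pos {a : ℝ} (ha : 0 < a) (r : ℝ) :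
    0 < (r ^ 2 - 1) ^ 2 + a * (r ^ 2 + 1) ^ 2 := by
  positivity

theorem hasDerivAt_cmcSphere_primitive {a : ℝ} (ha : 0 < a) (r : ℝ) :
    HasDerivAt
      (fun r : ℝ => (1 + a) * (r ^ 4 - 1) / ((r ^ 2 - 1) ^ 2 + a * (r ^ 2 + 1) ^ 2))
      (4 * (1 + a) * r * (a * (r ^ 2 + 1) ^ 2 - (r ^ 2 - 1) ^ 2) /
        ((r ^ 2 - 1) ^ 2 + a * (r ^ 2 + 1) ^ 2) ^ 2) r := by
  have hD := (cmcSphere_denom_pos ha r).ne'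
  have hnum : HasDerivAt (fun r : ℝ => (1 + a) * (r ^ 4 - 1)) ((1 + a) * (4 * r ^ 3)) r := by
    simpa using ((hasDerivAt_pow 4 r).sub_const 1).const_mul (1 + a)
  have hsq : HasDerivAt (fun r : ℝ => r ^ 2) (2 * r) r := by
    simpa using hasDerivAt_pow 2 r
  have hden : HasDerivAt (fun r : ℝ => (r ^ 2 - 1) ^ 2 + a * (r ^ 2 + 1) ^ 2)
      (2 * (r ^ 2 - 1) * (2 * r) + a * (2 * (r ^ 2 + 1) * (2 * r))) r := by
    simpa using ((hsq.sub_const 1).fun_pow 2).fun_add (((hsq.add_const 1).fun_pow 2).const_mul a)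
  refine (hnum.div hden hD).congr_deriv ?_
  congr 1
  ring

theorem tendsto_cmcSphere_primitive {a : ℝ} (ha : 0 < a) :
    Filter.Tendsto
      (fun r : ℝ => (1 + a) * (r ^ 4 - 1) / ((r ^ 2 - 1) ^ 2 + a * (r ^ 2 + 1) ^ 2))
      Filter.atTop (nhds 1) := by
  have hcont : Continuous fun u : ℝ =>
      (1 + a) * (1 - u ^ 4) / ((u ^ 2 - 1) ^ 2 + a * (u ^ 2 + 1) ^ 2) :=
    Continuous.div (by fun_prop) (by fun_prop) fun u => (cmcSphere_denom_pos ha u).ne'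
  have hlim := (hcont.tendsto 0).comp (tendsto_inv_atTop_zero (𝕜 := ℝ))
  have hone : (1 + a) * (1 - (0 : ℝ) ^ 4) / ((0 ^ 2 - 1) ^ 2 + a * (0 ^ 2 + 1) ^ 2) = 1 := by
    have : 1 + a ≠ 0 := by positivity
    norm_num [this]
  rw [hone] at hlim
  refine hlim.congr' ?_
  filter_upwards [Filter.eventually_gt_atTop 0] with r hr
  have hD := (cmcSphere_denom_pos ha r).ne'
  have hD' := (cmcSphere_denom_pos ha r⁻¹).ne'
  simp only [Function.comp_apply]
  rw [div_eq_div_iff hD' hD]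
  field_simp
  ring

theorem integrableOn_Ioi_div_one_add_sq_sq :
    IntegrableOn (fun r : ℝ => r / (r ^ 2 + 1) ^ 2) (Ioi 0) := by
  refine integrableOn_Ioi_deriv_of_nonneg' (g := fun r : ℝ => -(1 / 2) * (r ^ 2 + 1)⁻¹)
    (l := -(1 / 2) * 0) (fun r _ => ?_) (fun r hr => ?_) ?_
  · have hsq : HasDerivAt (fun r : ℝ => r ^ 2 + 1) (2 * r) r := by
      simpa using (hasDerivAt_pow 2 r).add_const 1
    refine ((hsq.fun_inv (by positivity)).const_mul (-(1 / 2))).congr_deriv ?_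
    ring
  · have : 0 < r := hr
    positivity
  · refine (Filter.Tendsto.inv_tendsto_atTop ?_).const_mul _
    exact Filter.tendsto_atTop_add_const_right _ _ (Filter.tendsto_pow_atTop two_ne_zero)

theorem integrableOn_cmcSphere_density {a : ℝ} (ha : 0 < a) :
    IntegrableOn
      (fun r : ℝ => 4 * (1 + a) * r * (a * (r ^ 2 + 1) ^ 2 - (r ^ 2 - 1) ^ 2) /
        ((r ^ 2 - 1) ^ 2 + a * (r ^ 2 + 1) ^ 2) ^ 2) (Ioi 0) := by
  refine Integrable.mono' (integrableOn_Ioi_div_one_add_sq_sq.const_mul (4 * (1 + a) / a)) ?_ ?_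
  · refine Continuous.aestronglyMeasurable ?_
    exact Continuous.div (by fun_prop) (by fun_prop)
      fun r => pow_ne_zero 2 (cmcSphere_denom_pos ha r).ne'
  · filter_upwards [ae_restrict_mem measurableSet_Ioi] with r hr
    have hr : 0 < r := hr
    have hD := cmcSphere_denom_pos ha r
    have hnum : |a * (r ^ 2 + 1) ^ 2 - (r ^ 2 - 1) ^ 2| ≤
        (r ^ 2 - 1) ^ 2 + a * (r ^ 2 + 1) ^ 2 := by
      have h₁ : 0 ≤ a * (r ^ 2 + 1) ^ 2 := by positivity
      have h₂ := sq_nonneg (r ^ 2 - 1)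
      exact abs_le.mpr ⟨by linarith, by linarith⟩
    have hden : a * (r ^ 2 + 1) ^ 2 ≤ (r ^ 2 - 1) ^ 2 + a * (r ^ 2 + 1) ^ 2 :=
      le_add_of_nonneg_left (sq_nonneg _)
    have hc : 0 < 4 * (1 + a) * r := by positivity
    rw [Real.norm_eq_abs, abs_div, abs_mul, abs_of_pos hc, abs_of_pos (pow_pos hD 2)]
    calc _ ≤ 4 * (1 + a) * r * ((r ^ 2 - 1) ^ 2 + a * (r ^ 2 + 1) ^ 2) /
          ((r ^ 2 - 1) ^ 2 + a * (r ^ 2 + 1) ^ 2) ^ 2 := by gcongr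
      _ = 4 * (1 + a) * r / ((r ^ 2 - 1) ^ 2 + a * (r ^ 2 + 1) ^ 2) := by
        field_simp
      _ ≤ 4 * (1 + a) * r / (a * (r ^ 2 + 1) ^ 2) := by gcongr
      _ = 4 * (1 + a) / a * (r / (r ^ 2 + 1) ^ 2) := by
        field_simp

theorem integral_cmcSphere_density {a : ℝ} (ha : 0 < a) :
    ∫ r in Ioi (0 : ℝ), 4 * (1 + a) * r * (a * (r ^ 2 + 1) ^ 2 - (r ^ 2 - 1) ^ 2) /
        ((r ^ 2 - 1) ^ 2 + a * (r ^ 2 + 1) ^ 2) ^ 2 = 2 := by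
  rw [integral_Ioi_of_hasDerivAt_of_tendsto' (fun r _ => hasDerivAt_cmcSphere_primitive ha r)
    (integrableOn_cmcSphere_density ha) (tendsto_cmcSphere_primitive ha)]
  have : 1 + a ≠ 0 := by positivity
  field_simp
  norm_num
  ring

/-- The spinor energy `E(S_H) = (π/2) ∫₀^∞ (H² − n₃²/4) e^{2α_H} r dr` of the cmc
sphere `S_H` in the Heisenberg group converges and equals `π` for every `H > 0`. -/
theorem spinor_energy_of_cmc_sphere_in_Nil (H : ℝ) (hH : 0 < H) :
    IntegrableOn
      (fun r : ℝ =>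
        (H ^ 2 - 1 / 4 * ((r ^ 2 - 1) / (r ^ 2 + 1)) ^ 2) *
          (16 * (1 + 4 * H ^ 2) * (1 + r ^ 2) ^ 2 /
            ((r ^ 2 - 1) ^ 2 + 4 * H ^ 2 * (r ^ 2 + 1) ^ 2) ^ 2) * r)
      (Ioi (0 : ℝ)) ∧
    π / 2 * ∫ r in Ioi (0 : ℝ),
        (H ^ 2 - 1 / 4 * ((r ^ 2 - 1) / (r ^ 2 + 1)) ^ 2) *
          (16 * (1 + 4 * H ^ 2) * (1 + r ^ 2) ^ 2 /
            ((r ^ 2 - 1) ^ 2 + 4 * H ^ 2 * (r ^ 2 + 1) ^ 2) ^ 2) * r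
      = π := by
  have ha : 0 < 4 * H ^ 2 := by positivity
  have hfun (r : ℝ) :
      (H ^ 2 - 1 / 4 * ((r ^ 2 - 1) / (r ^ 2 + 1)) ^ 2) *
          (16 * (1 + 4 * H ^ 2) * (1 + r ^ 2) ^ 2 /
            ((r ^ 2 - 1) ^ 2 + 4 * H ^ 2 * (r ^ 2 + 1) ^ 2) ^ 2) * r =
        4 * (1 + 4 * H ^ 2) * r * (4 * H ^ 2 * (r ^ 2 + 1) ^ 2 - (r ^ 2 - 1) ^ 2) /
          ((r ^ 2 - 1) ^ 2 + 4 * H ^ 2 * (r ^ 2 + 1) ^ 2) ^ 2 := by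
    have hD := (cmcSphere_denom_pos ha r).ne'
    have hr : r ^ 2 + 1 ≠ 0 := by positivity
    generalize (r ^ 2 - 1) ^ 2 + 4 * H ^ 2 * (r ^ 2 + 1) ^ 2 = D at hD ⊢
    field_simp
    ring
  simp only [hfun]
  refine ⟨integrableOn_cmcSphere_density ha, ?_⟩
  rw [integral_cmcSphere_density ha]
  ring
end

section
/- For every real H > 0, the improper integral 2π ∫₀^∞ ( H² + 1/4 − ((r²−1)/(r²+1))² ) · ( 16(1+4H²)(1+r²)² / ((r²−1)² + 4H²(r²+1)²)² ) · r dr converges and equals 10π + π/(2H²) − ( π (1+4H²)(3H² − 1/4) / (2H³) ) ( π/2 − arctan((4H²−1)/(4H)) ). -/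
open MeasureTheory Real Set

lemma sq_sub_one_div_sq_add_one_mem_Icc (r : ℝ) :
    (r ^ 2 - 1) / (r ^ 2 + 1) ∈ Icc (-1 : ℝ) 1 := by
  have hpos : 0 < r ^ 2 + 1 := by positivity
  rw [mem_Icc, le_div_iff₀ hpos, div_le_one hpos]
  constructor <;> nlinarith [sq_nonneg r]

lemma integrableOn_four_mul_div_sq_add_one_sq :
    IntegrableOn (fun r : ℝ => 4 * r / (r ^ 2 + 1) ^ 2) (Ioi 0) :=
  integrableOn_Ioi_deriv_of_nonneg'
    (fun r _ => hasDerivAt_sq_sub_one_div_sq_add_one r)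
    (fun r hr => by have : 0 < r := hr; positivity)
    tendsto_sq_sub_one_div_sq_add_one

lemma integrableOn_comp_mul_deriv_sq_sub_one_div {h : ℝ → ℝ} (hc : Continuous h) :
    IntegrableOn (fun r : ℝ => h ((r ^ 2 - 1) / (r ^ 2 + 1)) * (4 * r / (r ^ 2 + 1) ^ 2))
      (Ioi 0) := by
  obtain ⟨C, hC⟩ := isCompact_Icc.exists_bound_of_continuousOn
    (hc.continuousOn (s := Icc (-1 : ℝ) 1))
  have ht : Continuous fun r : ℝ => (r ^ 2 - 1) / (r ^ 2 + 1) :=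
    continuous_iff_continuousAt.2 fun r =>
      (hasDerivAt_sq_sub_one_div_sq_add_one r).continuousAt
  exact Integrable.bdd_mul integrableOn_four_mul_div_sq_add_one_sq
    (hc.comp ht).aestronglyMeasurable
    (Filter.Eventually.of_forall fun r => hC _ (sq_sub_one_div_sq_add_one_mem_Icc r))

/-- The substitution `t = (r² - 1) / (r² + 1)` maps `(0, ∞)` to `(-1, 1)`. -/
lemma integral_comp_mul_deriv_sq_sub_one_div {h G : ℝ → ℝ} (hc : Continuous h)
    (hG : ∀ t, HasDerivAt G (h t) t) :
    ∫ r in Ioi (0 : ℝ), h ((r ^ 2 - 1) / (r ^ 2 + 1)) * (4 * r / (r ^ 2 + 1) ^ 2) =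
      G 1 - G (-1) := by
  have key := integral_Ioi_of_hasDerivAt_of_tendsto'
    (f := fun r : ℝ => G ((r ^ 2 - 1) / (r ^ 2 + 1)))
    (fun r _ => (hG _).comp r (hasDerivAt_sq_sub_one_div_sq_add_one r))
    (integrableOn_comp_mul_deriv_sq_sub_one_div hc)
    ((hG 1).continuousAt.tendsto.comp tendsto_sq_sub_one_div_sq_add_one)
  simpa using key

lemma hasDerivAt_primitive_sub_sq_div_sq {a : ℝ} (ha : 0 < a) (c t : ℝ) :
    HasDerivAt
      (fun t : ℝ => (c + a ^ 2) / (2 * a ^ 2) * (t / (t ^ 2 + a ^ 2)) +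
        (c - a ^ 2) / (2 * a ^ 3) * arctan (t / a))
      ((c - t ^ 2) / (t ^ 2 + a ^ 2) ^ 2) t := by
  have hne : t ^ 2 + a ^ 2 ≠ 0 := by positivity
  have h2 : HasDerivAt (fun t : ℝ => t ^ 2 + a ^ 2) (2 * t) t := by
    simpa using (hasDerivAt_pow 2 t).add_const (a ^ 2)
  have h3 := ((hasDerivAt_id' t).div h2 hne).const_mul ((c + a ^ 2) / (2 * a ^ 2))
  have h4 := ((hasDerivAt_id' t).div_const a).arctan.const_mul ((c - a ^ 2) / (2 * a ^ 3))
  refine (h3.add h4).congr_deriv ?_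
  have h5 : 1 + (t / a) ^ 2 = (t ^ 2 + a ^ 2) / a ^ 2 := by field_simp; ring
  rw [h5]
  field_simp
  ring

lemma pi_div_two_sub_arctan_eq_two_mul_arctan_inv {a : ℝ} (ha : 0 < a) :
    π / 2 - arctan ((a ^ 2 - 1) / (2 * a)) = 2 * arctan a⁻¹ := by
  have h1 : 0 < arctan a⁻¹ := arctan_pos.2 (inv_pos.2 ha)
  have h2 := arctan_lt_pi_div_two a⁻¹
  have h : arctan ((a ^ 2 - 1) / (2 * a)) = π / 2 - 2 * arctan a⁻¹ := by
    refine arctan_eq_of_tan_eq ?_ ⟨by linarith, by linarith⟩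
    rw [tan_pi_div_two_sub, tan_two_mul, tan_arctan, inv_div]
    field_simp
  linarith

/-- The classical Willmore functional `W(S_H) = ∫ (H² + K̂) dμ` of the cmc sphere
`S_H` in the Heisenberg group: the improper integral converges and equals the
explicit (non-constant in `H`) formula. -/
theorem willmore_of_cmc_sphere_in_Nil (H : ℝ) (hH : 0 < H) :
    IntegrableOn
      (fun r : ℝ =>
        (H ^ 2 + 1 / 4 - ((r ^ 2 - 1) / (r ^ 2 + 1)) ^ 2) *
          (16 * (1 + 4 * H ^ 2) * (1 + r ^ 2) ^ 2 /
            ((r ^ 2 - 1) ^ 2 + 4 * H ^ 2 * (r ^ 2 + 1) ^ 2) ^ 2) * r)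
      (Ioi (0 : ℝ)) ∧
    2 * π * ∫ r in Ioi (0 : ℝ),
        (H ^ 2 + 1 / 4 - ((r ^ 2 - 1) / (r ^ 2 + 1)) ^ 2) *
          (16 * (1 + 4 * H ^ 2) * (1 + r ^ 2) ^ 2 /
            ((r ^ 2 - 1) ^ 2 + 4 * H ^ 2 * (r ^ 2 + 1) ^ 2) ^ 2) * r
      = 10 * π + π / (2 * H ^ 2) -
          π * (1 + 4 * H ^ 2) * (3 * H ^ 2 - 1 / 4) / (2 * H ^ 3) *
            (π / 2 - arctan ((4 * H ^ 2 - 1) / (4 * H))) := by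
  have ha : 0 < 2 * H := by positivity
  set h : ℝ → ℝ := fun t => (H ^ 2 + 1 / 4 - t ^ 2) / (t ^ 2 + (2 * H) ^ 2) ^ 2 with h_def
  have hc : Continuous h :=
    Continuous.div (by fun_prop) (by fun_prop) fun t => by positivity
  have hf : (fun r : ℝ =>
        (H ^ 2 + 1 / 4 - ((r ^ 2 - 1) / (r ^ 2 + 1)) ^ 2) *
          (16 * (1 + 4 * H ^ 2) * (1 + r ^ 2) ^ 2 /
            ((r ^ 2 - 1) ^ 2 + 4 * H ^ 2 * (r ^ 2 + 1) ^ 2) ^ 2) * r) =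
      fun r => 4 * (1 + 4 * H ^ 2) *
        (h ((r ^ 2 - 1) / (r ^ 2 + 1)) * (4 * r / (r ^ 2 + 1) ^ 2)) := by
    funext r
    have hs : r ^ 2 + 1 ≠ 0 := by positivity
    have hD : (r ^ 2 - 1) ^ 2 + 4 * H ^ 2 * (r ^ 2 + 1) ^ 2 ≠ 0 := by positivity
    have hD' : ((r ^ 2 - 1) / (r ^ 2 + 1)) ^ 2 + (2 * H) ^ 2 =
        ((r ^ 2 - 1) ^ 2 + 4 * H ^ 2 * (r ^ 2 + 1) ^ 2) / (r ^ 2 + 1) ^ 2 := by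
      field_simp
      ring
    simp only [h_def]
    rw [hD', add_comm 1 (r ^ 2)]
    generalize (r ^ 2 - 1) ^ 2 + 4 * H ^ 2 * (r ^ 2 + 1) ^ 2 = D at hD
    field_simp
    ring
  rw [hf]
  refine ⟨(integrableOn_comp_mul_deriv_sq_sub_one_div hc).const_mul _, ?_⟩
  rw [integral_const_mul, integral_comp_mul_deriv_sq_sub_one_div hc
    (hasDerivAt_primitive_sub_sq_div_sq ha (H ^ 2 + 1 / 4))]
  have harg : (4 * H ^ 2 - 1) / (4 * H) = ((2 * H) ^ 2 - 1) / (2 * (2 * H)) := by ring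
  rw [harg, pi_div_two_sub_arctan_eq_two_mul_arctan_inv ha, neg_div (2 * H) 1, arctan_neg, one_div (2 * H)]
  generalize arctan (2 * H)⁻¹ = θ
  have hE : (1 : ℝ) + 4 * H ^ 2 ≠ 0 := by positivity
  rw [show (2 * H) ^ 2 = 4 * H ^ 2 by ring, neg_div, neg_one_sq, one_pow]
  field_simp
  ring
end

section
/- Let u : ℝ² → ℝ be given by u(x,y) = (x²+y²−1)/(x²+y²+1). Then for every (x,y) ≠ (0,0), one has 1 − u(x,y)² ≠ 0 and ∂²u/∂x² + ∂²u/∂y² + 2 u ( (∂u/∂x)² + (∂u/∂y)² ) / (1 − u²) = 0 at (x,y). -/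
/-- The third normal component of the cmc spheres of revolution in the Heisenberg
group, `u(x,y) = (x²+y²−1)/(x²+y²+1)`. -/
noncomputable def nThree (x y : ℝ) : ℝ := (x ^ 2 + y ^ 2 - 1) / (x ^ 2 + y ^ 2 + 1)

theorem nThree_comm (x y : ℝ) : nThree x y = nThree y x := by
  unfold nThree
  rw [add_comm (x ^ 2)]

theorem one_sub_nThree_sq (x y : ℝ) :
    1 - nThree x y ^ 2 = 4 * (x ^ 2 + y ^ 2) / (x ^ 2 + y ^ 2 + 1) ^ 2 := by
  have hD : x ^ 2 + y ^ 2 + 1 ≠ 0 := by positivity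
  unfold nThree
  field_simp
  ring

theorem deriv_nThree_left (x y : ℝ) :
    deriv (fun t => nThree t y) x = 4 * x / (x ^ 2 + y ^ 2 + 1) ^ 2 := by
  have hD : x ^ 2 + y ^ 2 + 1 ≠ 0 := by positivity
  have hsq : HasDerivAt (fun t : ℝ => t ^ 2 + y ^ 2) (2 * x) x := by
    simpa using (hasDerivAt_pow 2 x).add_const (y ^ 2)
  refine (((hsq.sub_const 1).div (hsq.add_const 1) hD).congr_deriv ?_).deriv
  field_simp
  ring

theorem deriv_deriv_nThree_left (x y : ℝ) :
    deriv (fun s => deriv (fun t => nThree t y) s) x =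
      4 / (x ^ 2 + y ^ 2 + 1) ^ 2 - 16 * x ^ 2 / (x ^ 2 + y ^ 2 + 1) ^ 3 := by
  have hD : x ^ 2 + y ^ 2 + 1 ≠ 0 := by positivity
  simp only [deriv_nThree_left]
  have hsq : HasDerivAt (fun t : ℝ => t ^ 2 + y ^ 2 + 1) (2 * x) x := by
    simpa using ((hasDerivAt_pow 2 x).add_const (y ^ 2)).add_const 1
  refine ((((hasDerivAt_id x).const_mul 4).div (hsq.pow 2) (pow_ne_zero 2 hD)).congr_deriv
    ?_).deriv
  simp only [Pi.pow_apply, id_eq]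
  field_simp
  ring

/-- The function `u(x,y) = (x²+y²−1)/(x²+y²+1)` satisfies the main equation
`Δu + 2u(uₓ² + u_y²)/(1 − u²) = 0` away from the origin, where `1 − u² ≠ 0`. -/
theorem nThree_solves_main_equation (x y : ℝ) (h : (x, y) ≠ (0, 0)) :
    1 - (nThree x y) ^ 2 ≠ 0 ∧
    deriv (fun x' => deriv (fun x'' => nThree x'' y) x') x +
      deriv (fun y' => deriv (fun y'' => nThree x y'') y') y +
      2 * nThree x y *
        ((deriv (fun x' => nThree x' y) x) ^ 2 +
          (deriv (fun y' => nThree x y') y) ^ 2) /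
        (1 - (nThree x y) ^ 2) = 0 := by
  have hr : x ^ 2 + y ^ 2 ≠ 0 := by
    intro h0
    refine h (Prod.ext ?_ ?_) <;> dsimp only <;> nlinarith [sq_nonneg x, sq_nonneg y]
  have hD : x ^ 2 + y ^ 2 + 1 ≠ 0 := by positivity
  simp only [nThree_comm x]
  simp only [deriv_deriv_nThree_left]
  simp only [deriv_nThree_left, one_sub_nThree_sq, add_comm (y ^ 2)]
  refine ⟨by positivity, ?_⟩
  rw [nThree_comm, nThree]
  field_simp
  ring
end

section
/- Let H > 0 be real and define h : ℝ → ℝ by h(r) = ((1+4H²)/(4H²)) ( −4H(1 − r² + 4H²(1+r²)) / ( (r²−1)² + 16H⁴(1+r²)² + 8H²(1+r⁴) ) + arctan( (r² − 1 + 4H²(r²+1)) / (4H) ) ). Then for every r ∈ ℝ, h is differentiable at r with derivative h′(r) = 16 H (1+4H²) r (1+r²)² / ( (r²−1)² + 4H²(1+r²)² )². -/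
open Real

/-- The height component `h(r)` of the generating curve of the cmc sphere `S_H` in
the Heisenberg group is differentiable with derivative
`h′(r) = 16H(1+4H²)r(1+r²)²/((r²−1)² + 4H²(1+r²)²)²`. -/
theorem hasDerivAt_height_of_cmc_sphere (H : ℝ) (hH : 0 < H) (r : ℝ) :
    HasDerivAt
      (fun r : ℝ =>
        (1 + 4 * H ^ 2) / (4 * H ^ 2) *
          (-(4 * H * (1 - r ^ 2 + 4 * H ^ 2 * (1 + r ^ 2))) /
              ((r ^ 2 - 1) ^ 2 + 16 * H ^ 4 * (1 + r ^ 2) ^ 2 +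
                8 * H ^ 2 * (1 + r ^ 4)) +
            arctan ((r ^ 2 - 1 + 4 * H ^ 2 * (r ^ 2 + 1)) / (4 * H))))
      (16 * H * (1 + 4 * H ^ 2) * r * (1 + r ^ 2) ^ 2 /
        ((r ^ 2 - 1) ^ 2 + 4 * H ^ 2 * (1 + r ^ 2) ^ 2) ^ 2)
      r := by
  have hE : ∀ x : ℝ, (x ^ 2 - 1) ^ 2 + 16 * H ^ 4 * (1 + x ^ 2) ^ 2 + 8 * H ^ 2 * (1 + x ^ 4) =
      (1 + 4 * H ^ 2) * ((x ^ 2 - 1) ^ 2 + 4 * H ^ 2 * (1 + x ^ 2) ^ 2) := fun x => by ring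
  have hD : (r ^ 2 - 1) ^ 2 + 4 * H ^ 2 * (1 + r ^ 2) ^ 2 ≠ 0 := by positivity
  have hA : 1 + 4 * H ^ 2 ≠ 0 := by positivity
  simp only [hE]
  have hsq : HasDerivAt (fun x : ℝ => x ^ 2) (2 * r) r := by
    simpa using hasDerivAt_pow 2 r
  have hnum := ((hsq.const_sub 1).add ((hsq.const_add 1).const_mul (4 * H ^ 2))).const_mul (4 * H)
  have hden := (((hsq.sub_const 1).pow 2).add
    (((hsq.const_add 1).pow 2).const_mul (4 * H ^ 2))).const_mul (1 + 4 * H ^ 2)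
  have harg := ((hsq.sub_const 1).add ((hsq.add_const 1).const_mul (4 * H ^ 2))).div_const (4 * H)
  have harctan : 1 + ((r ^ 2 - 1 + 4 * H ^ 2 * (r ^ 2 + 1)) / (4 * H)) ^ 2 =
      (1 + 4 * H ^ 2) * ((r ^ 2 - 1) ^ 2 + 4 * H ^ 2 * (1 + r ^ 2) ^ 2) / (16 * H ^ 2) := by
    field_simp
    ring
  refine ((hnum.neg.div hden (mul_ne_zero hA hD)).add harg.arctan).const_mul
    ((1 + 4 * H ^ 2) / (4 * H ^ 2)) |>.congr_deriv ?_
  simp only [Pi.add_apply, Pi.neg_apply, Pi.pow_apply]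
  rw [harctan]
  field_simp
  ring
end

section
/- Let a < b be reals and let u, σ : ℝ → ℝ be such that σ is continuously differentiable on [a,b], u is differentiable on [a,b] with u′(s) = cos(σ(s)) for all s ∈ [a,b], and u(s) > 0 for all s ∈ [a,b]. Then ∫ₐᵇ ( (σ′(s) + sin σ(s)/u(s))²/4 − cos²σ(s)/(4 + u(s)²) ) u(s) √(4 + u(s)²) ds = (1/4) ∫ₐᵇ (σ′(s) − sin σ(s)/u(s))² u(s) √(4 + u(s)²) ds − ( u′(b) √(4 + u(b)²) − u′(a) √(4 + u(a)²) ). -/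
open Real intervalIntegral

/-- The spinor-energy integrand of a surface of revolution in the Heisenberg group,
written via the arclength parametrization `(u(s), v(s))` of the generating curve
with angle function `σ` (so that `u′ = cos σ`), equals a nonnegative quadratic term
plus the total derivative of `u′ √(4+u²)`:
`∫ ((σ′ + sin σ/u)²/4 − cos²σ/(4+u²)) u√(4+u²) ds
   = (1/4) ∫ (σ′ − sin σ/u)² u√(4+u²) ds − (u′√(4+u²))|ₐᵇ`. -/
theorem energy_integrand_identity_for_surfaces_of_revolution
    (a b : ℝ) (hab : a < b) (u σ σ' : ℝ → ℝ)
    (hσ : ∀ s ∈ Set.Icc a b, HasDerivAt σ (σ' s) s)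
    (hσ'cont : ContinuousOn σ' (Set.Icc a b))
    (hu : ∀ s ∈ Set.Icc a b, HasDerivAt u (Real.cos (σ s)) s)
    (hupos : ∀ s ∈ Set.Icc a b, 0 < u s) :
    (∫ s in a..b,
        ((σ' s + Real.sin (σ s) / u s) ^ 2 / 4 -
          Real.cos (σ s) ^ 2 / (4 + u s ^ 2)) *
          (u s * Real.sqrt (4 + u s ^ 2)))
      = (1 / 4) * (∫ s in a..b,
            (σ' s - Real.sin (σ s) / u s) ^ 2 * (u s * Real.sqrt (4 + u s ^ 2)))
        - (Real.cos (σ b) * Real.sqrt (4 + u b ^ 2) -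
            Real.cos (σ a) * Real.sqrt (4 + u a ^ 2)) := by
  have hσc : ContinuousOn σ (Set.Icc a b) := fun s hs =>
    (hσ s hs).continuousAt.continuousWithinAt
  have huc : ContinuousOn u (Set.Icc a b) := fun s hs =>
    (hu s hs).continuousAt.continuousWithinAt
  have hu0 : ∀ s ∈ Set.Icc a b, u s ≠ 0 := fun s hs => (hupos s hs).ne'
  have h4 : ∀ s, 0 < 4 + u s ^ 2 := fun s => by positivity
  have hsin : ContinuousOn (fun s => Real.sin (σ s)) (Set.Icc a b) :=
    Real.continuous_sin.comp_continuousOn hσc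
  have hcos : ContinuousOn (fun s => Real.cos (σ s)) (Set.Icc a b) :=
    Real.continuous_cos.comp_continuousOn hσc
  have hquot : ContinuousOn (fun s => Real.sin (σ s) / u s) (Set.Icc a b) :=
    hsin.div huc hu0
  have hrad : ContinuousOn (fun s => 4 + u s ^ 2) (Set.Icc a b) :=
    continuousOn_const.add (huc.pow 2)
  have hsqrt : ContinuousOn (fun s => Real.sqrt (4 + u s ^ 2)) (Set.Icc a b) := hrad.sqrt
  have hE : IntervalIntegrable (fun s => ((σ' s + Real.sin (σ s) / u s) ^ 2 / 4 -
      Real.cos (σ s) ^ 2 / (4 + u s ^ 2)) * (u s * Real.sqrt (4 + u s ^ 2)))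
      MeasureTheory.volume a b :=
    ContinuousOn.intervalIntegrable_of_Icc hab.le
      (((((hσ'cont.add hquot).pow 2).div_const 4).sub
        ((hcos.pow 2).div hrad fun s _ => (h4 s).ne')).mul (huc.mul hsqrt))
  have hQ : IntervalIntegrable (fun s => (1 / 4) *
      ((σ' s - Real.sin (σ s) / u s) ^ 2 * (u s * Real.sqrt (4 + u s ^ 2))))
      MeasureTheory.volume a b :=
    ContinuousOn.intervalIntegrable_of_Icc hab.le
      (continuousOn_const.mul (((hσ'cont.sub hquot).pow 2).mul (huc.mul hsqrt)))
  have hderiv : ∀ s ∈ Set.uIcc a b,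
      HasDerivAt (fun s => Real.cos (σ s) * Real.sqrt (4 + u s ^ 2))
        ((1 / 4) * ((σ' s - Real.sin (σ s) / u s) ^ 2 * (u s * Real.sqrt (4 + u s ^ 2))) -
          ((σ' s + Real.sin (σ s) / u s) ^ 2 / 4 - Real.cos (σ s) ^ 2 / (4 + u s ^ 2)) *
            (u s * Real.sqrt (4 + u s ^ 2))) s := by
    intro s hs
    rw [Set.uIcc_of_le hab.le] at hs
    have hus := hu0 s hs
    have hr : Real.sqrt (4 + u s ^ 2) ≠ 0 := (Real.sqrt_pos.2 (h4 s)).ne'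
    have hsq : 4 + u s ^ 2 = Real.sqrt (4 + u s ^ 2) ^ 2 := (Real.sq_sqrt (h4 s).le).symm
    refine ((hσ s hs).cos.mul ((((hu s hs).pow 2).const_add 4).sqrt (h4 s).ne')).congr_deriv ?_
    simp only [Pi.pow_apply]
    generalize Real.sqrt (4 + u s ^ 2) = r at hr hsq ⊢
    rw [hsq]
    field_simp
    ring
  have hFTC := integral_eq_sub_of_hasDerivAt hderiv (hQ.sub hE)
  rw [integral_sub hQ hE, integral_const_mul] at hFTC
  linarith
end

section
/- Let a < b be reals and let u, σ : ℝ → ℝ be such that u is continuously differentiable on [a,b], σ is continuously differentiable on (a,b), u′(s) = cos(σ(s)) for all s ∈ (a,b), u(s) > 0 for all s ∈ (a,b), u(a) = u(b) = 0, u′(a) = 1, u′(b) = −1, and the function s ↦ ( (σ′(s) + sin σ(s)/u(s))²/4 − cos²σ(s)/(4 + u(s)²) ) u(s) √(4 + u(s)²) is integrable on (a,b). Then (π/4) ∫ₐᵇ ( (σ′(s) + sin σ(s)/u(s))²/4 − cos²σ(s)/(4 + u(s)²) ) u(s) √(4 + u(s)²) ds ≥ π, with equality if and only if σ′(s) = sin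 σ(s)/u(s) for all s ∈ (a,b). -/
open MeasureTheory Real Set

/-- If `f` dominates the derivative of `F` on `(a, b)` and both have the same total integral,
then `f` is equal to this derivative on `(a, b)`. -/
theorem eq_deriv_of_deriv_le_of_integral_eq_sub {a b : ℝ} {f F F' : ℝ → ℝ}
    (hF : ContinuousOn F (Icc a b)) (hF' : ∀ x ∈ Ioo a b, HasDerivAt F (F' x) x)
    (hle : ∀ x ∈ Ioo a b, F' x ≤ f x) (hf : ContinuousOn f (Ioo a b))
    (hint : IntervalIntegrable f volume a b) (heq : ∫ x in a..b, f x = F b - F a)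
    {x : ℝ} (hx : x ∈ Ioo a b) : f x = F' x := by
  have hsub : ∀ c d, a ≤ c → c ≤ d → d ≤ b →
      IntervalIntegrable f volume c d ∧ F d - F c ≤ ∫ t in c..d, f t := by
    intro c d hac hcd hdb
    have hcdint : IntervalIntegrable f volume c d :=
      hint.mono_set (by
        rw [uIcc_of_le hcd, uIcc_of_le (hac.trans (hcd.trans hdb))]
        exact Icc_subset_Icc hac hdb)
    refine ⟨hcdint, intervalIntegral.sub_le_integral_of_hasDeriv_right_of_le hcd
      (hF.mono (Icc_subset_Icc hac hdb))
      (fun t ht => (hF' t (Ioo_subset_Ioo hac hdb ht)).hasDerivWithinAt)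
      ((intervalIntegrable_iff_integrableOn_Icc_of_le hcd).1 hcdint)
      (fun t ht => hle t (Ioo_subset_Ioo hac hdb ht))⟩
  have hprim : ∀ y ∈ Ioo a b, ∫ t in a..y, f t = F y - F a := by
    intro y hy
    obtain ⟨hi₁, h₁⟩ := hsub a y le_rfl hy.1.le hy.2.le
    obtain ⟨hi₂, h₂⟩ := hsub y b hy.1.le hy.2.le le_rfl
    have := intervalIntegral.integral_add_adjacent_intervals hi₁ hi₂
    linarith
  have hderiv : HasDerivAt (fun y => ∫ t in a..y, f t) (f x) x :=
    intervalIntegral.integral_hasDerivAt_right (hsub a x le_rfl hx.1.le hx.2.le).1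
      (hf.stronglyMeasurableAtFilter isOpen_Ioo x hx)
      (hf.continuousAt (isOpen_Ioo.mem_nhds hx))
  refine hderiv.unique (((hF' x hx).sub_const (F a)).congr_of_eventuallyEq ?_)
  filter_upwards [isOpen_Ioo.mem_nhds hx] with y hy using hprim y hy

/-- Completing the square in the spinor energy density. -/
theorem spinor_energy_density_eq {p s c u : ℝ} (hu : 0 < u) :
    ((p + s / u) ^ 2 / 4 - c ^ 2 / (4 + u ^ 2)) * (u * √(4 + u ^ 2)) =
      (p - s / u) ^ 2 / 4 * (u * √(4 + u ^ 2)) +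
        (s * p * √(4 + u ^ 2) - c * (u * c / √(4 + u ^ 2))) := by
  have hpos : 0 < √(4 + u ^ 2) := by positivity
  have hsq : 4 + u ^ 2 = √(4 + u ^ 2) ^ 2 := (Real.sq_sqrt (by positivity)).symm
  set q := √(4 + u ^ 2)
  rw [hsq]
  field_simp
  ring

/-- The total derivative appearing in the spinor energy density of an arclength parametrized
generating curve. -/
theorem hasDerivAt_neg_cos_mul_sqrt {u σ : ℝ → ℝ} {p s : ℝ}
    (hu : HasDerivAt u (cos (σ s)) s) (hσ : HasDerivAt σ p s) :
    HasDerivAt (fun t => -cos (σ t) * √(4 + u t ^ 2))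
      (sin (σ s) * p * √(4 + u s ^ 2) - cos (σ s) * (u s * cos (σ s) / √(4 + u s ^ 2))) s := by
  have hsqrt : HasDerivAt (fun t => √(4 + u t ^ 2)) _ s :=
    ((hu.fun_pow 2).const_add 4).sqrt (by positivity)
  refine (hσ.cos.neg.mul hsqrt).congr_deriv ?_
  have hpos : 0 < √(4 + u s ^ 2) := by positivity
  simp only [Pi.neg_apply]
  field_simp
  ring

/-- For spheres of revolution in the Heisenberg group, generated by an arclength
parametrized curve `(u(s), v(s))`, `s ∈ [a,b]`, with angle function `σ`
(`u′ = cos σ`, `u > 0` inside, `u(a) = u(b) = 0`, `u′(a) = 1`, `u′(b) = −1`),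
the spinor energy `E = (π/4) ∫ ((σ′ + sin σ/u)²/4 − cos²σ/(4+u²)) u√(4+u²) ds`
satisfies `E ≥ π`, with equality exactly when `σ′ = sin σ/u` (the cmc spheres). -/
theorem spinor_energy_spheres_of_revolution_ge_pi
    (a b : ℝ) (hab : a < b) (u σ u' σ' : ℝ → ℝ)
    (hu : ∀ s ∈ Icc a b, HasDerivAt u (u' s) s)
    (hu'cont : ContinuousOn u' (Icc a b))
    (hσ : ∀ s ∈ Ioo a b, HasDerivAt σ (σ' s) s)
    (hσ'cont : ContinuousOn σ' (Ioo a b))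
    (hu'cos : ∀ s ∈ Ioo a b, u' s = Real.cos (σ s))
    (hupos : ∀ s ∈ Ioo a b, 0 < u s)
    (hua : u a = 0) (hub : u b = 0) (hu'a : u' a = 1) (hu'b : u' b = -1)
    (hint : IntegrableOn
      (fun s =>
        ((σ' s + Real.sin (σ s) / u s) ^ 2 / 4 -
          Real.cos (σ s) ^ 2 / (4 + u s ^ 2)) *
          (u s * Real.sqrt (4 + u s ^ 2)))
      (Ioo a b)) :
    π ≤ π / 4 * ∫ s in Ioo a b,
        ((σ' s + Real.sin (σ s) / u s) ^ 2 / 4 -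
          Real.cos (σ s) ^ 2 / (4 + u s ^ 2)) *
          (u s * Real.sqrt (4 + u s ^ 2)) ∧
    ((π / 4 * ∫ s in Ioo a b,
        ((σ' s + Real.sin (σ s) / u s) ^ 2 / 4 -
          Real.cos (σ s) ^ 2 / (4 + u s ^ 2)) *
          (u s * Real.sqrt (4 + u s ^ 2))) = π ↔
      ∀ s ∈ Ioo a b, σ' s = Real.sin (σ s) / u s) := by
  set f : ℝ → ℝ := fun s =>
    ((σ' s + sin (σ s) / u s) ^ 2 / 4 - cos (σ s) ^ 2 / (4 + u s ^ 2)) *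
      (u s * √(4 + u s ^ 2))
  let F : ℝ → ℝ := fun s => -u' s * √(4 + u s ^ 2)
  let F' : ℝ → ℝ := fun s =>
    sin (σ s) * σ' s * √(4 + u s ^ 2) - cos (σ s) * (u s * cos (σ s) / √(4 + u s ^ 2))
  have hIoo : ∀ {s}, s ∈ Ioo a b → s ∈ Icc a b := fun hs => Ioo_subset_Icc_self hs
  have hucont : ContinuousOn u (Icc a b) := fun s hs => (hu s hs).continuousAt.continuousWithinAt
  have hσcont : ContinuousOn σ (Ioo a b) := fun s hs => (hσ s hs).continuousAt.continuousWithinAt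
  have hFcont : ContinuousOn F (Icc a b) := by fun_prop
  have hfcont : ContinuousOn f (Ioo a b) := by
    have hucont' := hucont.mono Ioo_subset_Icc_self
    have hne : ∀ s ∈ Ioo a b, u s ≠ 0 := fun s hs => (hupos s hs).ne'
    have hne' : ∀ s ∈ Ioo a b, 4 + u s ^ 2 ≠ 0 := fun s _ => by positivity
    fun_prop (disch := assumption)
  have hFderiv : ∀ s ∈ Ioo a b, HasDerivAt F (F' s) s := by
    intro s hs
    refine (hasDerivAt_neg_cos_mul_sqrt (hu'cos s hs ▸ hu s (hIoo hs))
      (hσ s hs)).congr_of_eventuallyEq ?_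
    filter_upwards [isOpen_Ioo.mem_nhds hs] with t ht
    simp only [F, hu'cos t ht]
  have hf_eq : ∀ s ∈ Ioo a b,
      f s = (σ' s - sin (σ s) / u s) ^ 2 / 4 * (u s * √(4 + u s ^ 2)) + F' s :=
    fun s hs => spinor_energy_density_eq (hupos s hs)
  have hweight : ∀ s ∈ Ioo a b, 0 < u s * √(4 + u s ^ 2) := fun s hs =>
    mul_pos (hupos s hs) (by positivity)
  have hle : ∀ s ∈ Ioo a b, F' s ≤ f s := by
    intro s hs
    have := hweight s hs
    rw [hf_eq s hs]
    exact le_add_of_nonneg_left (by positivity)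
  have hFdiff : F b - F a = 4 := by
    have hsqrt : √(4 : ℝ) = 2 := by
      rw [show (4 : ℝ) = 2 ^ 2 by norm_num]
      exact Real.sqrt_sq (by norm_num)
    simp only [F, hua, hub, hu'a, hu'b]
    norm_num [hsqrt]
  have hintIcc : IntegrableOn f (Icc a b) := by
    rwa [integrableOn_Icc_iff_integrableOn_Ioo]
  have hintab : IntervalIntegrable f volume a b :=
    (intervalIntegrable_iff_integrableOn_Icc_of_le hab.le).2 hintIcc
  have hset : ∫ s in Ioo a b, f s = ∫ s in a..b, f s := by
    rw [intervalIntegral.integral_of_le hab.le, integral_Ioc_eq_integral_Ioo]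
  have hge : F b - F a ≤ ∫ s in a..b, f s :=
    intervalIntegral.sub_le_integral_of_hasDeriv_right_of_le hab.le hFcont
      (fun s hs => (hFderiv s hs).hasDerivWithinAt) hintIcc hle
  rw [hset]
  refine ⟨by nlinarith [pi_pos], fun heq s hs => ?_, fun hcmc => ?_⟩
  · have heq' : ∫ s in a..b, f s = F b - F a := by
      rw [hFdiff]
      exact mul_left_cancel₀ (by positivity : π / 4 ≠ 0) (by linarith)
    have hfs := eq_deriv_of_deriv_le_of_integral_eq_sub hFcont hFderiv hle hfcont hintab heq' hs
    have hzero : (σ' s - sin (σ s) / u s) ^ 2 / 4 * (u s * √(4 + u s ^ 2)) = 0 := by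
      linarith [hf_eq s hs]
    have hsq := (mul_eq_zero.1 hzero).resolve_right (hweight s hs).ne'
    exact sub_eq_zero.1 (pow_eq_zero_iff two_ne_zero |>.1 (by linarith))
  · have hFf : ∀ s ∈ Ioo a b, HasDerivAt F (f s) s := by
      intro s hs
      have hfs : f s = F' s := by rw [hf_eq s hs, hcmc s hs]; ring
      exact hfs ▸ hFderiv s hs
    rw [intervalIntegral.integral_eq_sub_of_hasDerivAt_of_le hab.le hFcont hFf hintab, hFdiff]
    ring
end
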